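/- arXiv:1902.04774 — 6 statements merged into one kernel-verified Lean document; each statement's English description precedes it below -/
import Mathlib

section
/- Let n ≥ 1 and let W ∈ ℝ^{n×n} be a doubly stochastic matrix with nonnegative entries (every row sum and every column sum equals 1). Then for every integer t ≥ 1 and every column index j, the entries of the t-th matrix power satisfy ∑_{i=1}^{n} |[W^t]_{ij} − 1/n| ≤ √n · ‖W − (1/n)𝟏𝟏ᵀ‖^t, where 𝟏 ∈ ℝ^n is the all-ones vector and ‖·‖ denotes the operator norm induced by the Euclidean norm on ℝ^n. -/
open MeasureTheory ProbabilityTheory Finset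
open scoped RealInnerProductSpace Pointwise

noncomputable section

/-- `ℝ^m` with the Euclidean norm. -/
abbrev Euc (m : ℕ) := EuclideanSpace ℝ (Fin m)

/-- The square loss `θ(y) = (1/2)(hᵀy − z)²`. -/
def sqLoss {m : ℕ} (h : Euc m) (z : ℝ) (y : Euc m) : ℝ := (1/2) * (⟪h, y⟫ - z)^2

/-- The gradient `h (hᵀy − z)` of the square loss at `y`. -/
def sqLossGrad {m : ℕ} (h : Euc m) (z : ℝ) (y : Euc m) : Euc m := (⟪h, y⟫ - z) • h

/-- A matrix is doubly stochastic: nonnegative entries, every row and column sums to 1. -/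
def DoublyStochastic {n : ℕ} (W : Matrix (Fin n) (Fin n) ℝ) : Prop :=
  (∀ i j, 0 ≤ W i j) ∧ (∀ i, ∑ j, W i j = 1) ∧ (∀ j, ∑ i, W i j = 1)

/-- Operator norm of a matrix, induced by the Euclidean norm on `ℝ^n`. -/
def matOpNorm {n : ℕ} (M : Matrix (Fin n) (Fin n) ℝ) : ℝ :=
  ‖LinearMap.toContinuousLinearMap (Matrix.toEuclideanLin M)‖

/-- The averaging matrix `(1/n) 𝟏𝟏ᵀ`. -/
def avgMatrix (n : ℕ) : Matrix (Fin n) (Fin n) ℝ := Matrix.of fun _ _ => (n : ℝ)⁻¹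

theorem mul_avgMatrix_of_row_sum {n : ℕ} {W : Matrix (Fin n) (Fin n) ℝ}
    (hW : ∀ i, ∑ j, W i j = 1) : W * avgMatrix n = avgMatrix n := by
  ext i j
  simp [Matrix.mul_apply, avgMatrix, ← Finset.sum_mul, hW]

theorem avgMatrix_mul_of_col_sum {n : ℕ} {W : Matrix (Fin n) (Fin n) ℝ}
    (hW : ∀ j, ∑ i, W i j = 1) : avgMatrix n * W = avgMatrix n := by
  ext i j
  simp [Matrix.mul_apply, avgMatrix, ← Finset.mul_sum, hW]

theorem pow_mul_avgMatrix_of_row_sum {n : ℕ} {W : Matrix (Fin n) (Fin n) ℝ}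
    (hW : ∀ i, ∑ j, W i j = 1) (t : ℕ) : W ^ t * avgMatrix n = avgMatrix n := by
  induction t with
  | zero => simp
  | succ t ih => rw [pow_succ, mul_assoc, mul_avgMatrix_of_row_sum hW, ih]

theorem avgMatrix_mul_self {n : ℕ} (hn : n ≠ 0) :
    avgMatrix n * avgMatrix n = avgMatrix n :=
  mul_avgMatrix_of_row_sum fun i => by simp [avgMatrix, hn]

theorem DoublyStochastic.sub_avgMatrix_pow {n : ℕ} {W : Matrix (Fin n) (Fin n) ℝ}
    (hW : DoublyStochastic W) {t : ℕ} (ht : 1 ≤ t) :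
    (W - avgMatrix n) ^ t = W ^ t - avgMatrix n := by
  rcases eq_or_ne n 0 with rfl | hn
  · exact Subsingleton.elim _ _
  induction t, ht using Nat.le_induction with
  | base => simp
  | succ t _ ih =>
    rw [pow_succ, ih, sub_mul, mul_sub, mul_sub, pow_mul_avgMatrix_of_row_sum hW.2.1,
      avgMatrix_mul_of_col_sum hW.2.2, avgMatrix_mul_self hn, sub_self, sub_zero, pow_succ]

theorem matOpNorm_eq_norm_toEuclideanCLM {n : ℕ} (M : Matrix (Fin n) (Fin n) ℝ) :
    matOpNorm M = ‖Matrix.toEuclideanCLM (n := Fin n) (𝕜 := ℝ) M‖ := rfl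

theorem matOpNorm_pow_le {n : ℕ} (M : Matrix (Fin n) (Fin n) ℝ) {t : ℕ} (ht : 0 < t) :
    matOpNorm (M ^ t) ≤ matOpNorm M ^ t := by
  rw [matOpNorm_eq_norm_toEuclideanCLM, matOpNorm_eq_norm_toEuclideanCLM, map_pow]
  exact norm_pow_le' _ ht

theorem sqrt_sum_sq_col_le_matOpNorm {n : ℕ} (M : Matrix (Fin n) (Fin n) ℝ) (j : Fin n) :
    √(∑ i, M i j ^ 2) ≤ matOpNorm M := by
  have h := (Matrix.toEuclideanCLM (n := Fin n) (𝕜 := ℝ) M).le_opNorm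
    (EuclideanSpace.single j 1)
  simpa [EuclideanSpace.norm_eq, Matrix.ofLp_toEuclideanCLM,
    ← matOpNorm_eq_norm_toEuclideanCLM] using h

theorem sum_abs_le_sqrt_card_mul_sqrt_sum_sq {ι : Type*} [Fintype ι] (f : ι → ℝ) :
    ∑ i, |f i| ≤ √(Fintype.card ι) * √(∑ i, f i ^ 2) := by
  simpa using Real.sum_mul_le_sqrt_mul_sqrt Finset.univ (fun _ => 1) fun i => |f i|

/-- For a doubly stochastic `W`, the entries of `W^t` converge to `1/n`
in the column-wise `ℓ¹` sense, at rate `√n · ‖W − (1/n)𝟏𝟏ᵀ‖^t`. -/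
theorem doublyStochastic_pow_entries_close_to_avg
    {n : ℕ} (hn : 1 ≤ n) (W : Matrix (Fin n) (Fin n) ℝ) (hW : DoublyStochastic W)
    (t : ℕ) (ht : 1 ≤ t) (j : Fin n) :
    ∑ i, |(W ^ t) i j - (n : ℝ)⁻¹| ≤
      Real.sqrt n * matOpNorm (W - avgMatrix n) ^ t := by
  calc ∑ i, |(W ^ t) i j - (n : ℝ)⁻¹|
      = ∑ i, |((W - avgMatrix n) ^ t) i j| := by
        rw [hW.sub_avgMatrix_pow ht]; rfl
    _ ≤ √n * √(∑ i, ((W - avgMatrix n) ^ t) i j ^ 2) := by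
        simpa using sum_abs_le_sqrt_card_mul_sqrt_sum_sq fun i => ((W - avgMatrix n) ^ t) i j
    _ ≤ √n * matOpNorm (W - avgMatrix n) ^ t := by
        gcongr
        exact (sqrt_sum_sq_col_le_matOpNorm _ j).trans (matOpNorm_pow_le _ ht)
end
end

section
/- Fix integers n, m, T ≥ 1, a doubly stochastic matrix W ∈ ℝ^{n×n} with nonnegative entries, vectors h_i(t) ∈ ℝ^m and scalars z_i(t) ∈ ℝ for i ∈ {1,…,n}, t ∈ {1,…,T}, and a step size η > 0. Let x_i(1) ∈ ℝ^m be arbitrary and define the DOLR-FIF iterates x_i(t+1) = ∑_{j=1}^n W_{ij}·(x_j(t) − η·h_j(t)(h_j(t)ᵀx_j(t) − z_j(t))). Then for every y ∈ ℝ^m: ∑_{t=1}^{T} ∑_{i=1}^{n} [θ_{i,t}(x_i(t)) − θ_{i,t}(y)] ≤ (1/(2η)) ∑_{i=1}^{n} ‖x_i(1) − y‖² + (η/2) ∑_{t=1}^{T} ∑_{i=1}^{n} ‖h_i(t)(h_i(t)ᵀx_i(t) − z_i(t))‖². -/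
open MeasureTheory ProbabilityTheory Finset
open scoped RealInnerProductSpace Pointwise

noncomputable section

/-- The subgradient inequality for the square loss. -/
lemma sqLoss_sub_le_inner {m : ℕ} (h : Euc m) (z : ℝ) (x y : Euc m) :
    sqLoss h z x - sqLoss h z y ≤ ⟪sqLossGrad h z x, x - y⟫ := by
  simp only [sqLoss, sqLossGrad, real_inner_smul_left, inner_sub_right]
  nlinarith [sq_nonneg (⟪h, x⟫ - ⟪h, y⟫)]

/-- The excess loss is controlled by the progress of a gradient step of size `η`. -/
lemma sqLoss_sub_le_gradient_step {m : ℕ} (h : Euc m) (z : ℝ) {η : ℝ} (hη : 0 < η)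
    (x y : Euc m) :
    sqLoss h z x - sqLoss h z y ≤
      (1 / (2 * η)) * (‖x - y‖ ^ 2 - ‖x - η • sqLossGrad h z x - y‖ ^ 2)
        + (η / 2) * ‖sqLossGrad h z x‖ ^ 2 := by
  refine (sqLoss_sub_le_inner h z x y).trans_eq ?_
  rw [sub_right_comm, norm_sub_sq_real (x - y), real_inner_smul_right, norm_smul, mul_pow,
    Real.norm_eq_abs, sq_abs, real_inner_comm]
  field_simp
  ring

/-- A convex combination is no farther from `y`, in mean square, than the points it combines. -/
lemma norm_sum_smul_sub_sq_le {ι E : Type*} [Fintype ι] [SeminormedAddCommGroup E]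
    [NormedSpace ℝ E] (w : ι → ℝ) (hw : ∀ j, 0 ≤ w j) (hw1 : ∑ j, w j = 1)
    (v : ι → E) (y : E) :
    ‖∑ j, w j • v j - y‖ ^ 2 ≤ ∑ j, w j * ‖v j - y‖ ^ 2 := by
  have hy : ∑ j, w j • v j - y = ∑ j, w j • (v j - y) := by
    simp only [smul_sub, sum_sub_distrib, ← sum_smul, hw1, one_smul]
  have hconv : ConvexOn ℝ Set.univ fun u : E => ‖u‖ ^ 2 :=
    (convexOn_norm convex_univ).pow (fun _ _ => norm_nonneg _) 2
  rw [hy]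
  simpa using hconv.map_sum_le (t := univ) (fun j _ => hw j) hw1
    (p := fun j => v j - y) (fun _ _ => Set.mem_univ _)

/-- Mixing by a doubly stochastic matrix does not increase the total squared distance to `y`. -/
lemma DoublyStochastic.sum_norm_sub_sq_le {n : ℕ} {W : Matrix (Fin n) (Fin n) ℝ}
    (hW : DoublyStochastic W) {E : Type*} [SeminormedAddCommGroup E] [NormedSpace ℝ E]
    (v : Fin n → E) (y : E) :
    ∑ i, ‖∑ j, W i j • v j - y‖ ^ 2 ≤ ∑ j, ‖v j - y‖ ^ 2 := by
  obtain ⟨hnonneg, hrow, hcol⟩ := hW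
  calc ∑ i, ‖∑ j, W i j • v j - y‖ ^ 2
      ≤ ∑ i, ∑ j, W i j * ‖v j - y‖ ^ 2 :=
        sum_le_sum fun i _ => norm_sum_smul_sub_sq_le (W i) (hnonneg i) (hrow i) v y
    _ = ∑ j, ‖v j - y‖ ^ 2 := by
        rw [sum_comm]
        simp only [← sum_mul, hcol, one_mul]

/-- Basic descent inequality for the DOLR-FIF iterates: for every
comparator `y`, the cumulative excess loss is controlled by the initial distance
and the cumulative squared gradient magnitude. -/
theorem dolr_fif_descent_inequality
    {n m T : ℕ} (hn : 1 ≤ n) (hm : 1 ≤ m) (hT : 1 ≤ T)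
    (W : Matrix (Fin n) (Fin n) ℝ) (hW : DoublyStochastic W)
    (h : Fin n → ℕ → Euc m) (z : Fin n → ℕ → ℝ)
    (η : ℝ) (hη : 0 < η)
    (x : Fin n → ℕ → Euc m)
    (hrec : ∀ i, ∀ t ∈ Finset.Icc 1 T, x i (t + 1) =
      ∑ j, W i j • (x j t - η • sqLossGrad (h j t) (z j t) (x j t)))
    (y : Euc m) :
    ∑ t ∈ Finset.Icc 1 T, ∑ i,
        (sqLoss (h i t) (z i t) (x i t) - sqLoss (h i t) (z i t) y)
      ≤ (1 / (2 * η)) * ∑ i, ‖x i 1 - y‖ ^ 2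
        + (η / 2) * ∑ t ∈ Finset.Icc 1 T, ∑ i,
            ‖sqLossGrad (h i t) (z i t) (x i t)‖ ^ 2 := by
  have hstep : ∀ t ∈ Finset.Icc 1 T,
      ∑ i, (sqLoss (h i t) (z i t) (x i t) - sqLoss (h i t) (z i t) y) ≤
        (1 / (2 * η)) * (∑ i, ‖x i t - y‖ ^ 2 - ∑ i, ‖x i (t + 1) - y‖ ^ 2)
          + (η / 2) * ∑ i, ‖sqLossGrad (h i t) (z i t) (x i t)‖ ^ 2 := by
    intro t ht
    have hmix : ∑ i, ‖x i (t + 1) - y‖ ^ 2 ≤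
        ∑ i, ‖x i t - η • sqLossGrad (h i t) (z i t) (x i t) - y‖ ^ 2 := by
      simp only [fun i => hrec i t ht]
      exact hW.sum_norm_sub_sq_le _ y
    refine (sum_le_sum fun i _ =>
      sqLoss_sub_le_gradient_step (h i t) (z i t) hη (x i t) y).trans ?_
    rw [sum_add_distrib, ← mul_sum, ← mul_sum, sum_sub_distrib]
    gcongr
  have htel : ∑ t ∈ Finset.Icc 1 T,
      (∑ i, ‖x i t - y‖ ^ 2 - ∑ i, ‖x i (t + 1) - y‖ ^ 2) =
        ∑ i, ‖x i 1 - y‖ ^ 2 - ∑ i, ‖x i (T + 1) - y‖ ^ 2 := by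
    rw [← Finset.Ico_add_one_right_eq_Icc, ← neg_inj, ← sum_neg_distrib]
    simp only [neg_sub]
    exact sum_Ico_sub (fun t => ∑ i, ‖x i t - y‖ ^ 2) (by lia)
  refine (sum_le_sum hstep).trans ?_
  rw [sum_add_distrib, ← mul_sum, ← mul_sum, htel]
  gcongr
  exact sub_le_self _ (sum_nonneg fun i _ => by positivity)
end
end

section
/- Fix integers n, m ≥ 1, T ≥ 2, a doubly stochastic matrix W ∈ ℝ^{n×n} with nonnegative entries, data h_i(t) ∈ ℝ^m, z_i(t) ∈ ℝ with ‖h_i(t)‖² ≤ α for all i ∈ {1,…,n}, t ∈ {1,…,T} (α > 0), and a point y* ∈ ℝ^m with |h_i(t)ᵀy* − z_i(t)| ≤ θ* for all i, t (θ* > 0). Let 0 < β ≤ 1 and run the DOLR-FIF iterates x_i(t+1) = ∑_{j=1}^n W_{ij}·(x_j(t) − (1/(α T^β))·h_j(t)(h_j(t)ᵀx_j(t) − z_j(t))) from arbitrary x_i(1) ∈ ℝ^m. Then ∑_{t=1}^{T} ∑_{i=1}^{n} ‖h_i(t)(h_i(t)ᵀx_i(t) − z_i(t))‖² ≤ C₁·T^β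 + C₂·T, where C₁ = (2^β/(2^β − 1))·α²·∑_{i=1}^n ‖x_i(1) − y*‖² and C₂ = (2^β/(2^β − 1))·α·n·(θ*)². -/
open MeasureTheory ProbabilityTheory Finset
open scoped RealInnerProductSpace Pointwise

noncomputable section

/-- Averaging with a doubly stochastic matrix does not increase the total squared distance to a
point. -/
lemma DoublyStochastic.sum_norm_sq_sub_le {n m : ℕ} {W : Matrix (Fin n) (Fin n) ℝ}
    (hW : DoublyStochastic W) (v : Fin n → Euc m) (y : Euc m) :
    ∑ i, ‖(∑ j, W i j • v j) - y‖ ^ 2 ≤ ∑ j, ‖v j - y‖ ^ 2 := by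
  obtain ⟨hnonneg, hrow, hcol⟩ := hW
  have hconv : ConvexOn ℝ Set.univ fun u : Euc m => ‖u‖ ^ 2 :=
    convexOn_univ_norm.pow (fun _ _ => norm_nonneg _) 2
  calc ∑ i, ‖(∑ j, W i j • v j) - y‖ ^ 2
      ≤ ∑ i, ∑ j, W i j * ‖v j - y‖ ^ 2 := by
        refine Finset.sum_le_sum fun i _ => ?_
        have hshift : (∑ j, W i j • v j) - y = ∑ j, W i j • (v j - y) := by
          simp only [smul_sub, Finset.sum_sub_distrib, ← Finset.sum_smul, hrow, one_smul]
        rw [hshift]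
        exact hconv.map_sum_le (fun j _ => hnonneg i j) (hrow i) fun _ _ => Set.mem_univ _
    _ = ∑ j, ‖v j - y‖ ^ 2 := by
        rw [Finset.sum_comm]
        simp only [← Finset.sum_mul, hcol, one_mul]

/-- One gradient step on the square loss, compared with a point of small residual. -/
lemma norm_sq_sub_smul_sqLossGrad_sub_le {m : ℕ} {h x y : Euc m} {z α γ θ : ℝ} (hγ : 0 ≤ γ)
    (hh : ‖h‖ ^ 2 ≤ α) (hy : |⟪h, y⟫ - z| ≤ θ) :
    ‖x - γ • sqLossGrad h z x - y‖ ^ 2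
      ≤ ‖x - y‖ ^ 2 - γ * (1 - γ * α) * (⟪h, x⟫ - z) ^ 2 + γ * θ ^ 2 := by
  have hsplit : x - γ • sqLossGrad h z x - y = (x - y) - (γ * (⟪h, x⟫ - z)) • h := by
    rw [sqLossGrad, smul_smul]
    abel
  rw [hsplit, norm_sub_sq_real, real_inner_smul_right, norm_smul, mul_pow, Real.norm_eq_abs,
    sq_abs, real_inner_comm h (x - y), inner_sub_right]
  have hres : (⟪h, y⟫ - z) ^ 2 ≤ θ ^ 2 := sq_le_sq' (abs_le.mp hy).1 (abs_le.mp hy).2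
  have hquad := mul_le_mul_of_nonneg_left hh (sq_nonneg (γ * (⟪h, x⟫ - z)))
  have hcross := mul_nonneg hγ (sq_nonneg (⟪h, x⟫ - ⟪h, y⟫))
  have hres' := mul_le_mul_of_nonneg_left hres hγ
  linarith

lemma norm_sq_sqLossGrad_le {m : ℕ} {h : Euc m} {α : ℝ} (hh : ‖h‖ ^ 2 ≤ α) (z : ℝ) (x : Euc m) :
    ‖sqLossGrad h z x‖ ^ 2 ≤ α * (⟪h, x⟫ - z) ^ 2 := by
  rw [sqLossGrad, norm_smul, mul_pow, Real.norm_eq_abs, sq_abs, mul_comm]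
  exact mul_le_mul_of_nonneg_right hh (sq_nonneg _)

/-- Telescoping a one-step descent inequality. -/
lemma add_sum_Icc_le_of_descent {T : ℕ} {Φ R : ℕ → ℝ} {c : ℝ}
    (hstep : ∀ t ∈ Finset.Icc 1 T, Φ (t + 1) + R t ≤ Φ t + c) :
    Φ (T + 1) + ∑ t ∈ Finset.Icc 1 T, R t ≤ Φ 1 + T * c := by
  induction T with
  | zero => simp
  | succ k ih =>
    have hprev := ih fun t ht => hstep t (Finset.Icc_subset_Icc_right k.le_succ ht)
    have hlast := hstep (k + 1) (by simp)
    rw [Finset.sum_Icc_succ_top (by omega)]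
    push_cast
    linarith

/-- Weighted residuals of the distributed gradient iterates with constant step size `γ`. -/
lemma DoublyStochastic.mul_sum_residual_sq_le {n m T : ℕ} {W : Matrix (Fin n) (Fin n) ℝ}
    (hW : DoublyStochastic W) {h : Fin n → ℕ → Euc m} {z : Fin n → ℕ → ℝ} {α γ θ : ℝ}
    (hγ : 0 ≤ γ) (hh : ∀ i, ∀ t ∈ Finset.Icc 1 T, ‖h i t‖ ^ 2 ≤ α) {y : Euc m}
    (hy : ∀ i, ∀ t ∈ Finset.Icc 1 T, |⟪h i t, y⟫ - z i t| ≤ θ) {x : Fin n → ℕ → Euc m}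
    (hrec : ∀ i, ∀ t ∈ Finset.Icc 1 T, x i (t + 1) =
      ∑ j, W i j • (x j t - γ • sqLossGrad (h j t) (z j t) (x j t))) :
    γ * (1 - γ * α) * ∑ t ∈ Finset.Icc 1 T, ∑ i, (⟪h i t, x i t⟫ - z i t) ^ 2
      ≤ ∑ i, ‖x i 1 - y‖ ^ 2 + T * (n * (γ * θ ^ 2)) := by
  have hdescent := add_sum_Icc_le_of_descent (T := T) (Φ := fun t => ∑ i, ‖x i t - y‖ ^ 2)
    (R := fun t => γ * (1 - γ * α) * ∑ i, (⟪h i t, x i t⟫ - z i t) ^ 2)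
    (c := n * (γ * θ ^ 2)) fun t ht => by
      have havg : ∑ i, ‖x i (t + 1) - y‖ ^ 2
          ≤ ∑ j, ‖x j t - γ • sqLossGrad (h j t) (z j t) (x j t) - y‖ ^ 2 := by
        simp only [fun i => hrec i t ht]
        exact hW.sum_norm_sq_sub_le _ y
      have hsum := Finset.sum_le_sum fun i (_ : i ∈ Finset.univ) =>
        norm_sq_sub_smul_sqLossGrad_sub_le (x := x i t) hγ (hh i t ht) (hy i t ht)
      simp only [Finset.sum_add_distrib, Finset.sum_sub_distrib, ← Finset.mul_sum,
        Finset.sum_const, Finset.card_univ, Fintype.card_fin, nsmul_eq_mul] at hsum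
      linarith
  rw [← Finset.mul_sum] at hdescent
  have hnonneg : 0 ≤ ∑ i, ‖x i (T + 1) - y‖ ^ 2 := Finset.sum_nonneg fun _ _ => sq_nonneg _
  linarith

/-- Lemma 1(i). Cumulative squared gradient bound for DOLR-FIF with
step size `1/(α T^β)`. -/
theorem dolr_fif_cumulative_gradient_bound
    {n m T : ℕ} (hn : 1 ≤ n) (hm : 1 ≤ m) (hT : 2 ≤ T)
    (W : Matrix (Fin n) (Fin n) ℝ) (hW : DoublyStochastic W)
    (h : Fin n → ℕ → Euc m) (z : Fin n → ℕ → ℝ)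
    (α : ℝ) (hα : 0 < α)
    (hh : ∀ i, ∀ t ∈ Finset.Icc 1 T, ‖h i t‖ ^ 2 ≤ α)
    (ystar : Euc m) (θs : ℝ) (hθs : 0 < θs)
    (hys : ∀ i, ∀ t ∈ Finset.Icc 1 T, |⟪h i t, ystar⟫ - z i t| ≤ θs)
    (β : ℝ) (hβ0 : 0 < β) (hβ1 : β ≤ 1)
    (x : Fin n → ℕ → Euc m)
    (hrec : ∀ i, ∀ t ∈ Finset.Icc 1 T, x i (t + 1) =
      ∑ j, W i j • (x j t - (1 / (α * (T : ℝ) ^ β)) •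
        sqLossGrad (h j t) (z j t) (x j t))) :
    ∑ t ∈ Finset.Icc 1 T, ∑ i, ‖sqLossGrad (h i t) (z i t) (x i t)‖ ^ 2
      ≤ ((2 : ℝ) ^ β / ((2 : ℝ) ^ β - 1)) * α ^ 2 * (∑ i, ‖x i 1 - ystar‖ ^ 2) * (T : ℝ) ^ β
        + ((2 : ℝ) ^ β / ((2 : ℝ) ^ β - 1)) * α * n * θs ^ 2 * T := by
  have hp : (1 : ℝ) < 2 ^ β := Real.one_lt_rpow one_lt_two hβ0
  have hpτ : (2 : ℝ) ^ β ≤ (T : ℝ) ^ β :=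
    Real.rpow_le_rpow zero_le_two (by exact_mod_cast hT) hβ0.le
  have hτ : (0 : ℝ) < (T : ℝ) ^ β := by linarith
  have hmain := hW.mul_sum_residual_sq_le (by positivity) hh hys hrec
  have hgrad : ∑ t ∈ Finset.Icc 1 T, ∑ i, ‖sqLossGrad (h i t) (z i t) (x i t)‖ ^ 2
      ≤ α * ∑ t ∈ Finset.Icc 1 T, ∑ i, (⟪h i t, x i t⟫ - z i t) ^ 2 := by
    simp only [Finset.mul_sum]
    exact Finset.sum_le_sum fun t ht => Finset.sum_le_sum fun i _ =>
      norm_sq_sqLossGrad_le (hh i t ht) _ _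
  have hR : 0 ≤ ∑ t ∈ Finset.Icc 1 T, ∑ i, (⟪h i t, x i t⟫ - z i t) ^ 2 :=
    Finset.sum_nonneg fun _ _ => Finset.sum_nonneg fun _ _ => sq_nonneg _
  generalize ∑ t ∈ Finset.Icc 1 T, ∑ i, (⟪h i t, x i t⟫ - z i t) ^ 2 = R at *
  generalize ∑ i, ‖x i 1 - ystar‖ ^ 2 = E at *
  generalize (T : ℝ) ^ β = τ at *
  generalize (2 : ℝ) ^ β = p at *
  have hscaled : (1 - 1 / τ) * R ≤ α * τ * E + T * n * θs ^ 2 := by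
    have hmul := mul_le_mul_of_nonneg_left hmain (mul_pos hα hτ).le
    have hl : α * τ * (1 / (α * τ) * (1 - 1 / (α * τ) * α) * R) = (1 - 1 / τ) * R := by
      field_simp
    have hr : α * τ * (E + T * (n * (1 / (α * τ) * θs ^ 2))) = α * τ * E + T * n * θs ^ 2 := by
      field_simp
    rwa [hl, hr] at hmul
  have hfactor : (1 - 1 / p) * R ≤ α * τ * E + T * n * θs ^ 2 := by
    refine le_trans (mul_le_mul_of_nonneg_right ?_ hR) hscaled
    exact sub_le_sub_left (one_div_le_one_div_of_le (by linarith) hpτ) 1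
  have hp' : 0 < p - 1 := by linarith
  calc _ ≤ α * R := hgrad
    _ = p / (p - 1) * α * ((1 - 1 / p) * R) := by
        field_simp
    _ ≤ p / (p - 1) * α * (α * τ * E + T * n * θs ^ 2) :=
        mul_le_mul_of_nonneg_left hfactor (by positivity)
    _ = _ := by ring
end
end

section
/- Fix integers n, m ≥ 1, T ≥ 2, a doubly stochastic matrix W ∈ ℝ^{n×n} with nonnegative entries such that σ := ‖W − (1/n)𝟏𝟏ᵀ‖ < 1 (Euclidean operator norm), data h_i(t) ∈ ℝ^m, z_i(t) ∈ ℝ with ‖h_i(t)‖² ≤ α (α > 0) for all i, t, and a point y* ∈ ℝ^m with |h_i(t)ᵀy* − z_i(t)| ≤ θ* (θ* > 0) for all i, t. Let 0 < β ≤ 1 and run the DOLR-FIF iterates x_i(t+1) = ∑_{j=1}^n W_{ij}·(x_j(t) − (1/(α T^β))·h_j(t)(h_j(t)ᵀx_j(t) − z_j(t))). Then, with x̄(t) = (1/n)∑_{i=1}^n x_i(t), the cumulative disagreement satisfies ∑_{t=1}^{T} ∑_{i=1}^{n} ‖x_i(t) − x̄(t)‖ ≤ C₃ + C₄·T^{(1−β)/2}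 + C₅·T^{1−β}, where C₃ = ∑_{i=1}^n ‖x_i(1) − x̄(1)‖ + √n·(σ/(1−σ))·∑_{i=1}^n ‖x_i(1)‖, C₄ = n·(σ/(α(1−σ)))·√C₁, C₅ = n·(σ/(α(1−σ)))·√C₂, with C₁ = (2^β/(2^β−1))·α²·∑_i ‖x_i(1) − y*‖² and C₂ = (2^β/(2^β−1))·α·n·(θ*)². -/
open MeasureTheory ProbabilityTheory Finset
open scoped RealInnerProductSpace Pointwise

noncomputable section

/-- A real matrix acting on tuples of vectors has Euclidean gain at most its operator norm. -/
lemma sum_norm_sq_matrix_smul_le {n m : ℕ} (M : Matrix (Fin n) (Fin n) ℝ) (v : Fin n → Euc m) :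
    ∑ i, ‖∑ j, M i j • v j‖ ^ 2 ≤ matOpNorm M ^ 2 * ∑ j, ‖v j‖ ^ 2 := by
  have coordinate (k : Fin m) :
      ∑ i, (∑ j, M i j * v j k) ^ 2 ≤ matOpNorm M ^ 2 * ∑ j, v j k ^ 2 := by
    have hle := (LinearMap.toContinuousLinearMap (Matrix.toEuclideanLin M)).le_opNorm
      (WithLp.toLp 2 fun j => v j k)
    have hsq := pow_le_pow_left₀ (norm_nonneg _) hle 2
    rw [mul_pow, EuclideanSpace.real_norm_sq_eq, EuclideanSpace.real_norm_sq_eq] at hsq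
    simpa [matOpNorm, Matrix.mulVec, dotProduct] using hsq
  simp only [EuclideanSpace.real_norm_sq_eq]
  rw [Finset.sum_comm, Finset.sum_comm (s := Finset.univ (α := Fin n)), Finset.mul_sum]
  refine Finset.sum_le_sum fun k _ => ?_
  simpa using coordinate k

/-- Mixing by a doubly stochastic matrix does not increase the sum of squared norms. -/
lemma DoublyStochastic.sum_norm_sq_smul_le {n m : ℕ} {W : Matrix (Fin n) (Fin n) ℝ}
    (hW : DoublyStochastic W) (v : Fin n → Euc m) :
    ∑ i, ‖∑ j, W i j • v j‖ ^ 2 ≤ ∑ j, ‖v j‖ ^ 2 := by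
  obtain ⟨hnn, hrow, hcol⟩ := hW
  have jensen (i : Fin n) : ‖∑ j, W i j • v j‖ ^ 2 ≤ ∑ j, W i j * ‖v j‖ ^ 2 := by
    have hconv : ConvexOn ℝ Set.univ fun y : Euc m => ‖y‖ ^ 2 :=
      (convexOn_norm convex_univ).pow (fun _ _ => norm_nonneg _) 2
    simpa using hconv.map_sum_le (t := Finset.univ) (w := W i) (p := v)
      (fun j _ => hnn i j) (hrow i) (fun _ _ => Set.mem_univ _)
  calc _ ≤ ∑ i, ∑ j, W i j * ‖v j‖ ^ 2 := Finset.sum_le_sum fun i _ => jensen i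
    _ = _ := by
      rw [Finset.sum_comm]
      simp only [← Finset.sum_mul, hcol, one_mul]

/-- After mixing by a doubly stochastic `W`, the deviation from the mean is `W - (1/n) 𝟏𝟏ᵀ`
applied to the tuple, which may be translated by any constant vector. -/
lemma DoublyStochastic.sum_smul_sub_mean {n m : ℕ} (hn : 1 ≤ n) {W : Matrix (Fin n) (Fin n) ℝ}
    (hW : DoublyStochastic W) (u : Fin n → Euc m) (c : Euc m) (i : Fin n) :
    (∑ j, W i j • u j) - (n : ℝ)⁻¹ • ∑ k, ∑ j, W k j • u j
      = ∑ j, (W - avgMatrix n) i j • (u j - c) := by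
  obtain ⟨-, hrow, hcol⟩ := hW
  have hn0 : (n : ℝ) ≠ 0 := by positivity
  have hmean : ∑ k, ∑ j, W k j • u j = ∑ j, u j := by
    rw [Finset.sum_comm]
    simp only [← Finset.sum_smul, hcol, one_smul]
  have hzero : ∑ j, (W - avgMatrix n) i j = 0 := by
    simp [avgMatrix, hrow, hn0]
  simp only [smul_sub, Finset.sum_sub_distrib, ← Finset.sum_smul, hzero, zero_smul, sub_zero]
  rw [hmean]
  simp [avgMatrix, sub_smul, Finset.smul_sum]

/-- One gradient step on the square loss with step size `γ`. -/
lemma norm_sq_sub_smul_sqLossGrad_le {m : ℕ} (h y ystar : Euc m) (z γ α θs : ℝ) (hγ : 0 ≤ γ)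
    (hh : ‖h‖ ^ 2 ≤ α) (hys : |⟪h, ystar⟫ - z| ≤ θs) :
    ‖y - γ • sqLossGrad h z y - ystar‖ ^ 2
      ≤ ‖y - ystar‖ ^ 2 - γ * (1 - γ * α) * (⟪h, y⟫ - z) ^ 2 + γ * θs ^ 2 := by
  have hsq : (⟪h, ystar⟫ - z) ^ 2 ≤ θs ^ 2 := sq_le_sq' (abs_le.mp hys).1 (abs_le.mp hys).2
  have expand : ‖y - γ • sqLossGrad h z y - ystar‖ ^ 2
      = ‖y - ystar‖ ^ 2 - 2 * (γ * (⟪h, y⟫ - z)) * (⟪h, y⟫ - ⟪h, ystar⟫)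
        + (γ * (⟪h, y⟫ - z)) ^ 2 * ‖h‖ ^ 2 := by
    have : y - γ • sqLossGrad h z y - ystar = (y - ystar) - (γ * (⟪h, y⟫ - z)) • h := by
      rw [sqLossGrad, smul_smul]; abel
    rw [this, norm_sub_sq_real, inner_smul_right, real_inner_comm h (y - ystar), inner_sub_right, norm_smul,
      mul_pow, Real.norm_eq_abs, sq_abs]
    ring
  rw [expand]
  have h1 : (γ * (⟪h, y⟫ - z)) ^ 2 * ‖h‖ ^ 2 ≤ (γ * (⟪h, y⟫ - z)) ^ 2 * α :=
    mul_le_mul_of_nonneg_left hh (sq_nonneg _)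
  have h2 := mul_le_mul_of_nonneg_left hsq hγ
  have h3 := mul_nonneg hγ (sq_nonneg ((⟪h, y⟫ - z) - (⟪h, ystar⟫ - z)))
  nlinarith

lemma norm_sqLossGrad_sq_le {m : ℕ} {h : Euc m} {α : ℝ} (hh : ‖h‖ ^ 2 ≤ α) (z : ℝ) (y : Euc m) :
    ‖sqLossGrad h z y‖ ^ 2 ≤ α * (⟪h, y⟫ - z) ^ 2 := by
  rw [sqLossGrad, norm_smul, mul_pow, Real.norm_eq_abs, sq_abs, mul_comm]
  exact mul_le_mul_of_nonneg_right hh (sq_nonneg _)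

/-- Telescoping of a descent inequality. -/
lemma sum_le_of_descent {V r : ℕ → ℝ} {a b : ℝ} (T : ℕ) (hV : ∀ t, 0 ≤ V t)
    (hstep : ∀ t ∈ Finset.Icc 1 T, V (t + 1) ≤ V t - a * r t + b) :
    a * ∑ t ∈ Finset.Icc 1 T, r t ≤ V 1 + T * b := by
  have tele : ∀ k ≤ T, a * ∑ t ∈ Finset.Icc 1 k, r t + V (k + 1) ≤ V 1 + k * b := by
    intro k
    induction k with
    | zero => simp
    | succ k ih =>
      intro hk
      have h1 := ih (by omega)
      have h2 := hstep (k + 1) (Finset.mem_Icc.mpr ⟨by omega, hk⟩)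
      rw [Finset.sum_Icc_succ_top (by omega), mul_add]
      push_cast
      linarith
  linarith [tele T le_rfl, hV (T + 1)]

/-- Summation of the perturbed contraction `d (t+1) ≤ σ (d t + e t)`. -/
lemma sum_le_of_contraction {d e : ℕ → ℝ} {σ : ℝ} {T : ℕ} (hT : 1 ≤ T) (hσ0 : 0 ≤ σ)
    (hσ1 : σ < 1) (hd : ∀ t, 0 ≤ d t) (he : ∀ t, 0 ≤ e t)
    (hstep : ∀ t ∈ Finset.Icc 1 T, d (t + 1) ≤ σ * (d t + e t)) :
    ∑ t ∈ Finset.Icc 2 T, d t ≤ σ / (1 - σ) * (d 1 + ∑ t ∈ Finset.Icc 1 T, e t) := by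
  have key : ∀ k, 1 ≤ k → k ≤ T → (1 - σ) * ∑ t ∈ Finset.Icc 2 k, d t + σ * d k + σ * e k
      ≤ σ * (d 1 + ∑ t ∈ Finset.Icc 1 k, e t) := by
    intro k hk
    induction k, hk using Nat.le_induction with
    | base => intro _; simp [mul_add]
    | succ k hk ih =>
      intro hkT
      have h1 := ih (by omega)
      have h2 := hstep k (Finset.mem_Icc.mpr ⟨hk, by omega⟩)
      rw [Finset.sum_Icc_succ_top (by omega), Finset.sum_Icc_succ_top (by omega)]
      linarith
  rw [div_mul_eq_mul_div, le_div_iff₀ (by linarith)]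
  nlinarith [key T hT le_rfl, mul_nonneg hσ0 (hd T), mul_nonneg hσ0 (he T)]

/-- The sum of `n` norms is at most `√n` times their Euclidean combination. -/
lemma sum_norm_le_sqrt_mul_norm_toLp {n m : ℕ} (v : Fin n → Euc m) :
    ∑ i, ‖v i‖ ≤ √n * ‖WithLp.toLp 2 v‖ := by
  rw [PiLp.norm_eq_of_L2, ← Real.sqrt_mul (by positivity)]
  apply Real.le_sqrt_of_sq_le
  simpa using sq_sum_le_card_mul_sum_sq (s := Finset.univ) (f := fun i => ‖v i‖)

/-- The Euclidean combination of norms is at most their sum. -/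
lemma norm_toLp_le_sum_norm {n m : ℕ} (v : Fin n → Euc m) :
    ‖WithLp.toLp 2 v‖ ≤ ∑ i, ‖v i‖ := by
  rw [PiLp.norm_eq_of_L2]
  apply Real.sqrt_le_iff.mpr ⟨by positivity, ?_⟩
  exact Finset.sum_sq_le_sq_sum_of_nonneg fun i _ => norm_nonneg (v i)

/-- Subtracting the mean does not increase the Euclidean norm of a tuple. -/
lemma norm_toLp_sub_mean_le {n m : ℕ} (hn : 1 ≤ n) (v : Fin n → Euc m) :
    ‖WithLp.toLp 2 fun i => v i - (n : ℝ)⁻¹ • ∑ k, v k‖ ≤ ‖WithLp.toLp 2 v‖ := by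
  have hn0 : (n : ℝ) ≠ 0 := by positivity
  rw [PiLp.norm_eq_of_L2, PiLp.norm_eq_of_L2]
  apply Real.sqrt_le_sqrt
  simp only [norm_sub_sq_real, Finset.sum_add_distrib, Finset.sum_sub_distrib, ← Finset.mul_sum,
    ← sum_inner]
  set s := ∑ k, v k
  have : (n : ℝ) * ((n : ℝ)⁻¹ ^ 2 * ‖s‖ ^ 2) = (n : ℝ)⁻¹ * ‖s‖ ^ 2 := by field_simp
  simp only [inner_smul_right, real_inner_self_eq_norm_sq, norm_smul, mul_pow, Finset.sum_const,
    Finset.card_univ, Fintype.card_fin, nsmul_eq_mul, norm_inv, Real.norm_natCast, this]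
  have : 0 ≤ (n : ℝ)⁻¹ * ‖s‖ ^ 2 := by positivity
  linarith

lemma matOpNorm_nonneg {n : ℕ} (M : Matrix (Fin n) (Fin n) ℝ) : 0 ≤ matOpNorm M := norm_nonneg _

lemma norm_toLp_matrix_smul_le {n m : ℕ} (M : Matrix (Fin n) (Fin n) ℝ) (v : Fin n → Euc m) :
    ‖WithLp.toLp 2 fun i => ∑ j, M i j • v j‖ ≤ matOpNorm M * ‖WithLp.toLp 2 v‖ := by
  apply (sq_le_sq₀ (norm_nonneg _) (mul_nonneg (matOpNorm_nonneg M) (norm_nonneg _))).mp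
  rw [mul_pow, PiLp.norm_sq_eq_of_L2, PiLp.norm_sq_eq_of_L2]
  exact sum_norm_sq_matrix_smul_le M v

/-- The gradient energy accumulated over `T` rounds of the mixed gradient iteration. -/
lemma DoublyStochastic.sum_norm_sqLossGrad_sq_le {n m T : ℕ} {W : Matrix (Fin n) (Fin n) ℝ}
    (hW : DoublyStochastic W) {h : Fin n → ℕ → Euc m} {z : Fin n → ℕ → ℝ} {α γ κ θs : ℝ}
    (hα : 0 < α) (hγ : 0 < γ) (hκ : 0 < κ) (hκγ : κ⁻¹ ≤ 1 - γ * α)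
    (hh : ∀ i, ∀ t ∈ Finset.Icc 1 T, ‖h i t‖ ^ 2 ≤ α) {ystar : Euc m}
    (hys : ∀ i, ∀ t ∈ Finset.Icc 1 T, |⟪h i t, ystar⟫ - z i t| ≤ θs) {x : Fin n → ℕ → Euc m}
    (hrec : ∀ i, ∀ t ∈ Finset.Icc 1 T, x i (t + 1) =
      ∑ j, W i j • (x j t - γ • sqLossGrad (h j t) (z j t) (x j t))) :
    ∑ t ∈ Finset.Icc 1 T, ∑ i, ‖sqLossGrad (h i t) (z i t) (x i t)‖ ^ 2
      ≤ κ * α * (∑ i, ‖x i 1 - ystar‖ ^ 2) / γ + κ * α * n * θs ^ 2 * T := by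
  have descent := sum_le_of_descent (V := fun t => ∑ i, ‖x i t - ystar‖ ^ 2)
    (r := fun t => ∑ i, (⟪h i t, x i t⟫ - z i t) ^ 2) (a := γ * κ⁻¹) (b := n * (γ * θs ^ 2)) T
    (fun t => by positivity) (fun t ht => by
      have hmix := hW.sum_norm_sq_smul_le
        fun j => x j t - γ • sqLossGrad (h j t) (z j t) (x j t) - ystar
      have hshift (i : Fin n) : x i (t + 1) - ystar
          = ∑ j, W i j • (x j t - γ • sqLossGrad (h j t) (z j t) (x j t) - ystar) := by
        rw [hrec i t ht]
        simp only [smul_sub _ _ ystar, Finset.sum_sub_distrib, ← Finset.sum_smul, hW.2.1, one_smul]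
      simp only [hshift]
      refine hmix.trans ?_
      calc _ ≤ ∑ j, (‖x j t - ystar‖ ^ 2 - γ * κ⁻¹ * (⟪h j t, x j t⟫ - z j t) ^ 2
              + γ * θs ^ 2) := Finset.sum_le_sum fun j _ => by
            have hstep := norm_sq_sub_smul_sqLossGrad_le (h j t) (x j t) ystar (z j t) γ α θs
              hγ.le (hh j t ht) (hys j t ht)
            have := mul_le_mul_of_nonneg_right (mul_le_mul_of_nonneg_left hκγ hγ.le)
              (sq_nonneg (⟪h j t, x j t⟫ - z j t))
            linarith
        _ = _ := by
            simp [Finset.sum_add_distrib, Finset.sum_sub_distrib, Finset.mul_sum])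
  have hgrad : ∑ t ∈ Finset.Icc 1 T, ∑ i, ‖sqLossGrad (h i t) (z i t) (x i t)‖ ^ 2
      ≤ α * ∑ t ∈ Finset.Icc 1 T, ∑ i, (⟪h i t, x i t⟫ - z i t) ^ 2 := by
    simp only [Finset.mul_sum]
    exact Finset.sum_le_sum fun t ht => Finset.sum_le_sum fun i _ =>
      norm_sqLossGrad_sq_le (hh i t ht) _ _
  refine hgrad.trans ?_
  have hscaled := mul_le_mul_of_nonneg_left descent (by positivity : 0 ≤ κ * α / γ)
  convert hscaled using 1 <;> field_simp

/-- One round of the mixed gradient iteration contracts the disagreement, up to the gradients. -/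
lemma DoublyStochastic.norm_disagreement_succ_le {n m : ℕ} (hn : 1 ≤ n)
    {W : Matrix (Fin n) (Fin n) ℝ} (hW : DoublyStochastic W) {γ : ℝ} (hγ : 0 ≤ γ)
    (y y' g : Fin n → Euc m) (hy' : ∀ i, y' i = ∑ j, W i j • (y j - γ • g j)) :
    ‖WithLp.toLp 2 fun i => y' i - (n : ℝ)⁻¹ • ∑ k, y' k‖
      ≤ matOpNorm (W - avgMatrix n)
        * (‖WithLp.toLp 2 fun i => y i - (n : ℝ)⁻¹ • ∑ k, y k‖ + γ * ‖WithLp.toLp 2 g‖) := by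
  simp only [hy', hW.sum_smul_sub_mean hn _ ((n : ℝ)⁻¹ • ∑ k, y k)]
  refine (norm_toLp_matrix_smul_le _ _).trans
    (mul_le_mul_of_nonneg_left ?_ (matOpNorm_nonneg _))
  have hsplit : (WithLp.toLp 2 fun j => y j - γ • g j - (n : ℝ)⁻¹ • ∑ k, y k)
      = (WithLp.toLp 2 fun j => y j - (n : ℝ)⁻¹ • ∑ k, y k) - γ • WithLp.toLp 2 g := by
    ext j : 1
    simp [sub_right_comm]
  rw [hsplit]
  refine (norm_sub_le _ _).trans_eq ?_
  rw [norm_smul, Real.norm_of_nonneg hγ]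

/-- Lemma 1(ii). Cumulative disagreement bound for DOLR-FIF with
step size `1/(α T^β)`. -/
theorem dolr_fif_cumulative_disagreement_bound
    {n m T : ℕ} (hn : 1 ≤ n) (hm : 1 ≤ m) (hT : 2 ≤ T)
    (W : Matrix (Fin n) (Fin n) ℝ) (hW : DoublyStochastic W)
    (σ : ℝ) (hσdef : σ = matOpNorm (W - avgMatrix n)) (hσ : σ < 1)
    (h : Fin n → ℕ → Euc m) (z : Fin n → ℕ → ℝ)
    (α : ℝ) (hα : 0 < α)
    (hh : ∀ i, ∀ t ∈ Finset.Icc 1 T, ‖h i t‖ ^ 2 ≤ α)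
    (ystar : Euc m) (θs : ℝ) (hθs : 0 < θs)
    (hys : ∀ i, ∀ t ∈ Finset.Icc 1 T, |⟪h i t, ystar⟫ - z i t| ≤ θs)
    (β : ℝ) (hβ0 : 0 < β) (hβ1 : β ≤ 1)
    (x : Fin n → ℕ → Euc m)
    (hrec : ∀ i, ∀ t ∈ Finset.Icc 1 T, x i (t + 1) =
      ∑ j, W i j • (x j t - (1 / (α * (T : ℝ) ^ β)) •
        sqLossGrad (h j t) (z j t) (x j t)))
    (C₁ C₂ C₃ C₄ C₅ : ℝ)
    (hC₁ : C₁ = ((2 : ℝ) ^ β / ((2 : ℝ) ^ β - 1)) * α ^ 2 * ∑ i, ‖x i 1 - ystar‖ ^ 2)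
    (hC₂ : C₂ = ((2 : ℝ) ^ β / ((2 : ℝ) ^ β - 1)) * α * n * θs ^ 2)
    (hC₃ : C₃ = (∑ i, ‖x i 1 - (n : ℝ)⁻¹ • ∑ k, x k 1‖)
      + Real.sqrt n * (σ / (1 - σ)) * ∑ i, ‖x i 1‖)
    (hC₄ : C₄ = n * (σ / (α * (1 - σ))) * Real.sqrt C₁)
    (hC₅ : C₅ = n * (σ / (α * (1 - σ))) * Real.sqrt C₂) :
    ∑ t ∈ Finset.Icc 1 T, ∑ i, ‖x i t - (n : ℝ)⁻¹ • ∑ k, x k t‖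
      ≤ C₃ + C₄ * (T : ℝ) ^ ((1 - β) / 2) + C₅ * (T : ℝ) ^ (1 - β) := by
  have hT0 : (0 : ℝ) < T := by positivity
  have hn0 : (1 : ℝ) ≤ n := by exact_mod_cast hn
  have hσ0 : 0 ≤ σ := hσdef ▸ matOpNorm_nonneg _
  have h2β : 1 < (2 : ℝ) ^ β := Real.one_lt_rpow (by norm_num) hβ0
  have hTβ : (2 : ℝ) ^ β ≤ (T : ℝ) ^ β :=
    Real.rpow_le_rpow (by norm_num) (by exact_mod_cast hT) hβ0.le
  set κ : ℝ := (2 : ℝ) ^ β / ((2 : ℝ) ^ β - 1) with hκ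
  set γ : ℝ := 1 / (α * (T : ℝ) ^ β) with hγ
  have hTβ0 : 0 < (T : ℝ) ^ β := by positivity
  have hγ0 : 0 < γ := by positivity
  have hκ0 : 0 < κ := div_pos (by linarith) (by linarith)
  have hκγ : κ⁻¹ ≤ 1 - γ * α := by
    have h1 : κ⁻¹ = 1 - ((2 : ℝ) ^ β)⁻¹ := by rw [hκ]; field_simp
    have h2 : γ * α = ((T : ℝ) ^ β)⁻¹ := by rw [hγ]; field_simp
    have h3 : ((T : ℝ) ^ β)⁻¹ ≤ ((2 : ℝ) ^ β)⁻¹ := inv_anti₀ (by positivity) hTβ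
    linarith
  have hC₁0 : 0 ≤ C₁ := by rw [hC₁]; positivity
  have hC₂0 : 0 ≤ C₂ := by rw [hC₂]; positivity
  set d : ℕ → ℝ := fun t => ‖WithLp.toLp 2 fun i => x i t - (n : ℝ)⁻¹ • ∑ k, x k t‖ with hd
  set g : ℕ → ℝ := fun t =>
    ‖WithLp.toLp 2 fun i => sqLossGrad (h i t) (z i t) (x i t)‖ with hg
  have energy : ∑ t ∈ Finset.Icc 1 T, g t ^ 2 ≤ C₁ * (T : ℝ) ^ β + C₂ * T := by
    have hg_sq (t : ℕ) : g t ^ 2 = ∑ i, ‖sqLossGrad (h i t) (z i t) (x i t)‖ ^ 2 := by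
      rw [hg, PiLp.norm_sq_eq_of_L2]
    simp only [hg_sq]
    refine (hW.sum_norm_sqLossGrad_sq_le hα hγ0 hκ0 hκγ hh hys hrec).trans_eq ?_
    rw [hC₁, hC₂, hγ]
    field_simp
  have gradSum : ∑ t ∈ Finset.Icc 1 T, g t
      ≤ √C₁ * (T : ℝ) ^ ((1 + β) / 2) + √C₂ * T := by
    have hcs : (∑ t ∈ Finset.Icc 1 T, g t) ^ 2 ≤ T * (C₁ * (T : ℝ) ^ β + C₂ * T) := by
      refine (sq_sum_le_card_mul_sum_sq (s := Finset.Icc 1 T) (f := g)).trans ?_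
      simpa using mul_le_mul_of_nonneg_left energy hT0.le
    refine (sq_le_sq₀ (by positivity) (by positivity)).mp (hcs.trans ?_)
    have hpow : ((T : ℝ) ^ ((1 + β) / 2)) ^ 2 = T * (T : ℝ) ^ β := by
      rw [← Real.rpow_natCast, ← Real.rpow_mul hT0.le, ← Real.rpow_one_add' hT0.le (by linarith)]
      congr 1
      push_cast
      ring
    have hcross : 0 ≤ 2 * (√C₁ * (T : ℝ) ^ ((1 + β) / 2)) * (√C₂ * T) := by positivity
    rw [add_sq, mul_pow, mul_pow, Real.sq_sqrt hC₁0, Real.sq_sqrt hC₂0, hpow]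
    linarith
  have tail : ∑ t ∈ Finset.Icc 2 T, d t
      ≤ σ / (1 - σ) * (d 1 + ∑ t ∈ Finset.Icc 1 T, γ * g t) :=
    sum_le_of_contraction (by omega) hσ0 hσ (fun _ => norm_nonneg _)
      (fun _ => mul_nonneg hγ0.le (norm_nonneg _)) fun t ht => by
        have := hW.norm_disagreement_succ_le hn hγ0.le (fun i => x i t) (fun i => x i (t + 1))
          (fun i => sqLossGrad (h i t) (z i t) (x i t)) fun i => hrec i t ht
        rwa [← hσdef] at this
  have initial : d 1 ≤ ∑ i, ‖x i 1‖ :=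
    (norm_toLp_sub_mean_le hn fun i => x i 1).trans (norm_toLp_le_sum_norm _)
  have hsqrt : √(n : ℝ) ≤ n := Real.sqrt_le_iff.mpr ⟨by positivity, by nlinarith⟩
  have hratio : 0 ≤ σ / (1 - σ) := div_nonneg hσ0 (by linarith)
  have hγpow₁ : γ * (T : ℝ) ^ ((1 + β) / 2) = α⁻¹ * (T : ℝ) ^ ((1 - β) / 2) := by
    have : (T : ℝ) ^ ((1 + β) / 2) = (T : ℝ) ^ ((1 - β) / 2) * (T : ℝ) ^ β := by
      rw [← Real.rpow_add hT0]; ring_nf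
    rw [this, hγ]
    field_simp
  have hγpow₂ : γ * T = α⁻¹ * (T : ℝ) ^ (1 - β) := by
    rw [Real.rpow_sub hT0, Real.rpow_one, hγ]
    field_simp
  have hgrad : ∑ t ∈ Finset.Icc 1 T, γ * g t
      ≤ α⁻¹ * (√C₁ * (T : ℝ) ^ ((1 - β) / 2) + √C₂ * (T : ℝ) ^ (1 - β)) := by
    rw [← Finset.mul_sum]
    calc _ ≤ γ * (√C₁ * (T : ℝ) ^ ((1 + β) / 2) + √C₂ * T) := by gcongr
      _ = √C₁ * (γ * (T : ℝ) ^ ((1 + β) / 2)) + √C₂ * (γ * T) := by ring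
      _ = _ := by rw [hγpow₁, hγpow₂]; ring
  have hsplit : Finset.Icc 1 T = insert 1 (Finset.Icc 2 T) := by
    ext t; simp only [Finset.mem_Icc, Finset.mem_insert]; omega
  rw [hsplit, Finset.sum_insert (by simp), hC₃, hC₄, hC₅]
  have htail : ∑ t ∈ Finset.Icc 2 T, ∑ i, ‖x i t - (n : ℝ)⁻¹ • ∑ k, x k t‖
      ≤ √n * ∑ t ∈ Finset.Icc 2 T, d t := by
    rw [Finset.mul_sum]
    exact Finset.sum_le_sum fun t _ => sum_norm_le_sqrt_mul_norm_toLp _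
  set A := α⁻¹ * (√C₁ * (T : ℝ) ^ ((1 - β) / 2) + √C₂ * (T : ℝ) ^ (1 - β)) with hA
  have hA0 : 0 ≤ A := by positivity
  have hbound : √n * ∑ t ∈ Finset.Icc 2 T, d t
      ≤ √n * (σ / (1 - σ)) * ∑ i, ‖x i 1‖ + n * (σ / (1 - σ)) * A :=
    calc _ ≤ √n * (σ / (1 - σ) * (∑ i, ‖x i 1‖ + A)) := by
          refine mul_le_mul_of_nonneg_left (tail.trans ?_) (by positivity)
          exact mul_le_mul_of_nonneg_left (add_le_add initial hgrad) hratio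
      _ = √n * (σ / (1 - σ)) * ∑ i, ‖x i 1‖ + √n * (σ / (1 - σ) * A) := by ring
      _ ≤ √n * (σ / (1 - σ)) * ∑ i, ‖x i 1‖ + n * (σ / (1 - σ) * A) := by gcongr
      _ = _ := by ring
  have hconst : n * (σ / (1 - σ)) * A
      = n * (σ / (α * (1 - σ))) * √C₁ * (T : ℝ) ^ ((1 - β) / 2)
        + n * (σ / (α * (1 - σ))) * √C₂ * (T : ℝ) ^ (1 - β) := by
    have : σ / (α * (1 - σ)) = σ / (1 - σ) * α⁻¹ := by
      rw [mul_comm α, ← div_div, div_eq_mul_inv _ α]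
    rw [this, hA]
    ring
  linarith
end
end

section
/- Let m ≥ 1, h ∈ ℝ^m, z ∈ ℝ, θ(y) = (1/2)(hᵀy − z)², and ε > 0. Let μ be the uniform probability measure on the closed unit ball of ℝ^m and define the smoothed loss θ̂(y) = ∫ θ(y + εv) dμ(v). Then for every y ∈ ℝ^m, |θ̂(y) − θ(y)| ≤ ‖h(hᵀy − z)‖·ε + ‖h‖²·ε². -/
open MeasureTheory ProbabilityTheory Finset
open scoped RealInnerProductSpace Pointwise

noncomputable section

/-- The uniform probability measure on the closed unit ball of `ℝ^m`:
Lebesgue measure restricted to the ball, normalized to total mass 1. -/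
def ballUniform (m : ℕ) : Measure (Euc m) :=
  (volume (Metric.closedBall (0 : Euc m) 1))⁻¹ •
    volume.restrict (Metric.closedBall (0 : Euc m) 1)

theorem isProbabilityMeasure_ballUniform (m : ℕ) : IsProbabilityMeasure (ballUniform m) where
  measure_univ := by
    simp only [ballUniform, Measure.smul_apply, Measure.restrict_apply_univ, smul_eq_mul]
    exact ENNReal.inv_mul_cancel
      (Metric.measure_closedBall_pos volume _ one_pos).ne' measure_closedBall_lt_top.ne

theorem ae_ballUniform_norm_le_one (m : ℕ) : ∀ᵐ v ∂(ballUniform m), ‖v‖ ≤ 1 := by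
  refine Measure.ae_smul_measure ?_ _
  filter_upwards [ae_restrict_mem Metric.isClosed_closedBall.measurableSet] with v hv
  simpa using hv

theorem continuous_sqLoss {m : ℕ} (h : Euc m) (z : ℝ) : Continuous (sqLoss h z) := by
  unfold sqLoss
  fun_prop

theorem abs_sqLoss_add_smul_sub_le {m : ℕ} (h : Euc m) (z : ℝ) {ε : ℝ} (hε : 0 ≤ ε)
    (y : Euc m) {v : Euc m} (hv : ‖v‖ ≤ 1) :
    |sqLoss h z (y + ε • v) - sqLoss h z y| ≤ ‖sqLossGrad h z y‖ * ε + ‖h‖ ^ 2 * ε ^ 2 := by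
  have hinner : |⟪h, v⟫| ≤ ‖h‖ :=
    (abs_real_inner_le_norm h v).trans (mul_le_of_le_one_right (norm_nonneg h) hv)
  have hsq : ⟪h, v⟫ ^ 2 ≤ ‖h‖ ^ 2 := sq_le_sq.mpr (by rwa [abs_of_nonneg (norm_nonneg h)])
  have expand : sqLoss h z (y + ε • v) - sqLoss h z y
      = (⟪h, y⟫ - z) * ⟪h, v⟫ * ε + 1 / 2 * (⟪h, v⟫ ^ 2 * ε ^ 2) := by
    simp only [sqLoss, inner_add_right, real_inner_smul_right]
    ring
  rw [expand, sqLossGrad, norm_smul, Real.norm_eq_abs]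
  refine (abs_add_le _ _).trans (add_le_add ?_ ?_)
  · rw [abs_mul, abs_mul, abs_of_nonneg hε]
    gcongr
  · rw [abs_of_nonneg (by positivity)]
    have := mul_le_mul_of_nonneg_right hsq (sq_nonneg ε)
    have : 0 ≤ ⟪h, v⟫ ^ 2 * ε ^ 2 := by positivity
    linarith

/-- Lemma 2(ii). The smoothed square loss
`θ̂(y) = E_{v ∈ B₁}[θ(y + εv)]` satisfies `|θ̂(y) − θ(y)| ≤ ‖h(hᵀy−z)‖ε + ‖h‖²ε²`. -/
theorem smoothed_sqLoss_close
    {m : ℕ} (hm : 1 ≤ m) (h : Euc m) (z : ℝ) (ε : ℝ) (hε : 0 < ε) (y : Euc m) :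
    |(∫ v, sqLoss h z (y + ε • v) ∂(ballUniform m)) - sqLoss h z y|
      ≤ ‖sqLossGrad h z y‖ * ε + ‖h‖ ^ 2 * ε ^ 2 := by
  have := isProbabilityMeasure_ballUniform m
  have hbound : ∀ᵐ v ∂(ballUniform m), ‖sqLoss h z (y + ε • v) - sqLoss h z y‖
      ≤ ‖sqLossGrad h z y‖ * ε + ‖h‖ ^ 2 * ε ^ 2 :=
    (ae_ballUniform_norm_le_one m).mono fun v hv => abs_sqLoss_add_smul_sub_le h z hε.le y hv
  have hcont : Continuous fun v : Euc m => sqLoss h z (y + ε • v) :=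
    (continuous_sqLoss h z).comp (by fun_prop)
  have hdiff : Integrable (fun v => sqLoss h z (y + ε • v) - sqLoss h z y) (ballUniform m) :=
    .of_bound (hcont.sub continuous_const).aestronglyMeasurable _ hbound
  have hint : Integrable (fun v => sqLoss h z (y + ε • v)) (ballUniform m) := by
    simpa [Pi.add_def] using hdiff.add (integrable_const (sqLoss h z y))
  simpa [integral_sub hint (integrable_const _)] using norm_integral_le_of_norm_le_const hbound
end
end

section
/- Let m ≥ 1, h ∈ ℝ^m, z ∈ ℝ, θ(y) = (1/2)(hᵀy − z)², and ε > 0. Let ν be the uniform probability measure on the unit sphere {u ∈ ℝ^m : ‖u‖ = 1} and μ the uniform probability measure on the closed unit ball of ℝ^m, and set θ̂(y) = ∫ θ(y + εv) dμ(v). Then for every y ∈ ℝ^m the two-point estimator is an unbiased estimator of the gradient of the smoothed loss: (m/(2ε))·∫ (θ(y + εu) − θ(y − εu))·u dν(u) = ∇θ̂(y) = h(hᵀy − z). -/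
open MeasureTheory ProbabilityTheory Finset
open scoped RealInnerProductSpace Pointwise

noncomputable section

/-- `ν` is the uniform probability measure on the unit sphere of `ℝ^m`: it is a probability
measure carried by the sphere and invariant under every linear isometry (rotation) of `ℝ^m`.
These properties uniquely characterize the normalized surface measure. -/
def IsUniformOnSphere {m : ℕ} (ν : Measure (Euc m)) : Prop :=
  IsProbabilityMeasure ν ∧ ν (Metric.sphere (0 : Euc m) 1)ᶜ = 0 ∧
    ∀ L : Euc m ≃ₗᵢ[ℝ] Euc m, Measure.map L ν = ν

/-- Continuous functions are integrable against a
finite measure carried by a compact set. -/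
theorem integrable_of_continuous_of_compl_null {m : ℕ} {F : Type*} [NormedAddCommGroup F]
    {ν : Measure (Euc m)} [IsFiniteMeasure ν] {K : Set (Euc m)} (hK : IsCompact K)
    (hν : ν Kᶜ = 0) {f : Euc m → F} (hf : Continuous f) : Integrable f ν := by
  have hr : ν.restrict K = ν := Measure.restrict_eq_self_of_ae_mem (by
    rw [ae_iff]; exact hν)
  have hi : IntegrableOn f K ν := hf.continuousOn.integrableOn_compact hK
  rwa [IntegrableOn, hr] at hi

namespace IsUniformOnSphere

variable {m : ℕ} {ν : Measure (Euc m)}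

theorem integrable {F : Type*} [NormedAddCommGroup F] (hν : IsUniformOnSphere ν)
    {f : Euc m → F} (hf : Continuous f) : Integrable f ν :=
  have := hν.1
  integrable_of_continuous_of_compl_null (isCompact_sphere 0 1) hν.2.1 hf

theorem integral_comp {F : Type*} [NormedAddCommGroup F] [NormedSpace ℝ F]
    (hν : IsUniformOnSphere ν) (L : Euc m ≃ₗᵢ[ℝ] Euc m) (f : Euc m → F) :
    ∫ u, f (L u) ∂ν = ∫ u, f u ∂ν := by
  conv_rhs => rw [← hν.2.2 L]
  exact (L.toHomeomorph.measurableEmbedding.integral_map f).symm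

theorem integral_inner_reflection (hν : IsUniformOnSphere ν) (a b : Euc m)
    (K : Submodule ℝ (Euc m)) :
    ∫ u, ⟪K.reflection a, u⟫ * ⟪K.reflection b, u⟫ ∂ν = ∫ u, ⟪a, u⟫ * ⟪b, u⟫ ∂ν := by
  rw [← hν.integral_comp K.reflection]
  simp only [LinearIsometryEquiv.inner_map_map]

theorem integral_inner_mul_inner_of_orthogonal (hν : IsUniformOnSphere ν) {a b : Euc m}
    (hab : ⟪a, b⟫ = 0) : ∫ u, ⟪a, u⟫ * ⟪b, u⟫ ∂ν = 0 := by
  have key := hν.integral_inner_reflection a b (ℝ ∙ a)ᗮ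
  rw [Submodule.reflection_orthogonalComplement_singleton_eq_neg,
    Submodule.reflection_mem_subspace_eq_self
      (Submodule.mem_orthogonal_singleton_iff_inner_right.mpr hab)] at key
  simp only [inner_neg_left, neg_mul, integral_neg] at key
  linarith

theorem integral_inner_sq_eq_of_norm_eq (hν : IsUniformOnSphere ν) {a b : Euc m}
    (hab : ‖a‖ = ‖b‖) : ∫ u, ⟪a, u⟫ * ⟪a, u⟫ ∂ν = ∫ u, ⟪b, u⟫ * ⟪b, u⟫ ∂ν := by
  rw [← hν.integral_inner_reflection a a (ℝ ∙ (a - b))ᗮ, Submodule.reflection_sub hab]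

theorem integral_coord_sq (hν : IsUniformOnSphere ν) (i : Fin m) :
    (m : ℝ) * ∫ u, ⟪EuclideanSpace.basisFun (Fin m) ℝ i, u⟫ *
      ⟪EuclideanSpace.basisFun (Fin m) ℝ i, u⟫ ∂ν = 1 := by
  have := hν.1
  let e := EuclideanSpace.basisFun (Fin m) ℝ
  have hsum : ∑ j, ∫ u, ⟪e j, u⟫ * ⟪e j, u⟫ ∂ν = 1 := by
    rw [← integral_finsetSum _ fun j _ => hν.integrable (by fun_prop)]
    have hae : ∀ᵐ u ∂ν, ∑ j, ⟪e j, u⟫ * ⟪e j, u⟫ = 1 := by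
      have hs : ∀ᵐ u ∂ν, u ∈ Metric.sphere (0 : Euc m) 1 := by
        rw [ae_iff]; exact hν.2.1
      filter_upwards [hs] with u hu
      have := e.sum_inner_mul_inner u u
      simp only [real_inner_comm, mem_sphere_zero_iff_norm] at this hu
      simp only [real_inner_comm, this, real_inner_self_eq_norm_sq, hu, one_pow]
    rw [integral_congr_ae hae]
    simp
  have hc : ∀ j, ∫ u, ⟪e j, u⟫ * ⟪e j, u⟫ ∂ν = ∫ u, ⟪e i, u⟫ * ⟪e i, u⟫ ∂ν := fun j =>
    hν.integral_inner_sq_eq_of_norm_eq (by simp)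
  simp only [hc, sum_const, card_univ, Fintype.card_fin, nsmul_eq_mul] at hsum
  exact hsum

/-- The second moment of the uniform measure on the unit sphere is `1/m` times the identity. -/
theorem smul_integral_inner_smul (hν : IsUniformOnSphere ν) (h : Euc m) :
    (m : ℝ) • ∫ u, ⟪h, u⟫ • u ∂ν = h := by
  let e := EuclideanSpace.basisFun (Fin m) ℝ
  refine InnerProductSpace.ext_inner_left_basis e.toBasis fun i => ?_
  rw [OrthonormalBasis.coe_toBasis, inner_smul_right,
    ← integral_inner (hν.integrable (by fun_prop))]
  have hort : ⟪h - ⟪e i, h⟫ • e i, e i⟫ = 0 := by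
    simp [inner_sub_left, inner_smul_left, real_inner_comm]
  have h0 := hν.integral_inner_mul_inner_of_orthogonal hort
  have hsplit : ∀ u, ⟪e i, ⟪h, u⟫ • u⟫ =
      ⟪e i, h⟫ * (⟪e i, u⟫ * ⟪e i, u⟫) + ⟪h - ⟪e i, h⟫ • e i, u⟫ * ⟪e i, u⟫ := fun u => by
    simp only [inner_sub_left, real_inner_smul_left, real_inner_smul_right]; ring
  simp only [hsplit]
  rw [integral_add (hν.integrable (by fun_prop)) (hν.integrable (by fun_prop)), h0,
    integral_const_mul]
  linear_combination ⟪e i, h⟫ * hν.integral_coord_sq i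

end IsUniformOnSphere

instance (m : ℕ) : IsProbabilityMeasure (ballUniform m) := by
  constructor
  have h0 : volume (Metric.closedBall (0 : Euc m) 1) ≠ 0 :=
    (Metric.measure_closedBall_pos volume _ one_pos).ne'
  simp [ballUniform, ENNReal.inv_mul_cancel h0 measure_closedBall_lt_top.ne]

theorem integrable_ballUniform {m : ℕ} {F : Type*} [NormedAddCommGroup F] {f : Euc m → F}
    (hf : Continuous f) : Integrable f (ballUniform m) :=
  integrable_of_continuous_of_compl_null (isCompact_closedBall 0 1)
    (by simp [ballUniform, Measure.restrict_apply Metric.isClosed_closedBall.measurableSet.compl])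
    hf

theorem integral_inner_ballUniform {m : ℕ} (h : Euc m) : ∫ v, ⟪h, v⟫ ∂(ballUniform m) = 0 := by
  have key : ∫ v in Metric.closedBall (0 : Euc m) 1, ⟪h, v⟫ =
      ∫ v in Metric.closedBall (0 : Euc m) 1, ⟪h, -v⟫ := by
    have := (Measure.measurePreserving_neg (volume : Measure (Euc m))).setIntegral_preimage_emb
      (MeasurableEquiv.neg (Euc m)).measurableEmbedding (fun v => ⟪h, v⟫)
      (Metric.closedBall (0 : Euc m) 1)
    rw [← this]
    simp
  simp only [inner_neg_right, integral_neg] at key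
  rw [ballUniform, integral_smul_measure, self_eq_neg.mp key, smul_zero]

/-- Smoothing the square loss over a centred ball shifts it by a constant. -/
theorem integral_sqLoss_ballUniform {m : ℕ} (h : Euc m) (z ε : ℝ) (w : Euc m) :
    ∫ v, sqLoss h z (w + ε • v) ∂(ballUniform m) =
      sqLoss h z w + ∫ v, (1 / 2) * (ε * ⟪h, v⟫) ^ 2 ∂(ballUniform m) := by
  have hsplit : ∀ v, sqLoss h z (w + ε • v) =
      sqLoss h z w + ((⟪h, w⟫ - z) * ε) * ⟪h, v⟫ + (1 / 2) * (ε * ⟪h, v⟫) ^ 2 := fun v => by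
    simp only [sqLoss, inner_add_right, real_inner_smul_right]; ring
  simp only [hsplit]
  rw [integral_add (integrable_ballUniform (by fun_prop)) (integrable_ballUniform (by fun_prop)),
    integral_add (integrable_ballUniform (by fun_prop)) (integrable_ballUniform (by fun_prop)),
    integral_const_mul, integral_inner_ballUniform]
  simp

theorem hasGradientAt_sqLoss {m : ℕ} (h : Euc m) (z : ℝ) (y : Euc m) :
    HasGradientAt (sqLoss h z) (sqLossGrad h z y) y := by
  rw [hasGradientAt_iff_hasFDerivAt]
  have h1 : HasFDerivAt (fun w : Euc m => ⟪h, w⟫ - z) (innerSL ℝ h) y :=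
    (innerSL ℝ h).hasFDerivAt.sub_const z
  refine ((h1.pow 2).const_mul (1 / 2)).congr_fderiv ?_
  ext v
  simp [sqLossGrad]
  ring

/-- Lemma 2(i), unbiasedness. The two-point estimator is an unbiased
estimator of the gradient of the smoothed loss, which equals `h(hᵀy − z)`. -/
theorem banditGrad_unbiased
    {m : ℕ} (hm : 1 ≤ m) (h : Euc m) (z : ℝ) (ε : ℝ) (hε : 0 < ε)
    (ν : Measure (Euc m)) (hν : IsUniformOnSphere ν) (y : Euc m) :
    ((m : ℝ) / (2 * ε)) •
        (∫ u, (sqLoss h z (y + ε • u) - sqLoss h z (y - ε • u)) • u ∂ν)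
      = gradient (fun w => ∫ v, sqLoss h z (w + ε • v) ∂(ballUniform m)) y
    ∧ gradient (fun w => ∫ v, sqLoss h z (w + ε • v) ∂(ballUniform m)) y
      = sqLossGrad h z y := by
  have hgrad : gradient (fun w => ∫ v, sqLoss h z (w + ε • v) ∂(ballUniform m)) y
      = sqLossGrad h z y := by
    simp only [integral_sqLoss_ballUniform]
    refine HasGradientAt.gradient ?_
    rw [hasGradientAt_iff_hasFDerivAt]
    exact (hasGradientAt_sqLoss h z y).hasFDerivAt.add_const _
  refine ⟨?_, hgrad⟩
  have hdiff : ∀ u, (sqLoss h z (y + ε • u) - sqLoss h z (y - ε • u)) • u =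
      (2 * ε * (⟪h, y⟫ - z)) • (⟪h, u⟫ • u) := fun u => by
    rw [smul_smul]
    simp only [sqLoss, inner_add_right, inner_sub_right, real_inner_smul_right]
    ring_nf
  simp only [hgrad, hdiff]
  rw [integral_smul, smul_smul, sqLossGrad]
  have hcoef : (m : ℝ) / (2 * ε) * (2 * ε * (⟪h, y⟫ - z)) = (⟪h, y⟫ - z) * m := by
    field_simp
  rw [hcoef, ← smul_smul, hν.smul_integral_inner_smul]
end
end
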